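/- arXiv:nlin/0302026 — 2 statements merged into one kernel-verified Lean document; each statement's English description precedes it below -/
import Mathlib

section
/- Let φ : ℝ → ℂ be a smooth solution of Airy's differential equation φ''(t) = t·φ(t), and for n ≥ 0 let τ_n(t) = det( φ^{(i+j)}(t) )_{0≤i,j≤n−1} (the n×n Hankel determinant of ordinary derivatives φ^{(k)} = (d/dt)^k φ, with τ_0 = 1). Then for every n ≥ 0, at every point t where τ_n(t) ≠ 0 and τ_{n+1}(t) ≠ 0, the functions q = (d/dt) log(τ_{n+1}/τ_n) and p = τ_{n+1}τ_{n−1}/τ_n² give a solution of the Hamiltonian system S_II with parameter α = n, i.e. q' = −2p − q² + t and p' = 2qp − n. -/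
section Hankel

open Matrix

variable {R S : Type*} [CommRing R] [CommRing S]

/-- The `n × n` Hankel determinant of a sequence. -/
def hankelDet (h : ℕ → R) (n : ℕ) : R :=
  det (of fun i j : Fin n => h (i + j))

/-- The Hankel determinant of size `n + 1` whose last row and column are taken at the
positions `a` and `b` instead of `n`. -/
def borderedHankelDet (h : ℕ → R) (n a b : ℕ) : R :=
  det (of fun i j : Fin n ⊕ Fin 1 =>
    h (Sum.elim (fun i : Fin n => (i : ℕ)) (fun _ => a) i +
      Sum.elim (fun j : Fin n => (j : ℕ)) (fun _ => b) j))

theorem map_hankelDet (f : R →+* S) (h : ℕ → R) (n : ℕ) :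
    f (hankelDet h n) = hankelDet (fun k => f (h k)) n := by
  rw [hankelDet, RingHom.map_det]
  rfl

theorem map_borderedHankelDet (f : R →+* S) (h : ℕ → R) (n a b : ℕ) :
    f (borderedHankelDet h n a b) = borderedHankelDet (fun k => f (h k)) n a b := by
  rw [borderedHankelDet, RingHom.map_det]
  rfl

theorem borderedHankelDet_comm (h : ℕ → R) (n a b : ℕ) :
    borderedHankelDet h n a b = borderedHankelDet h n b a := by
  rw [borderedHankelDet, ← det_transpose, borderedHankelDet]
  congr 1
  ext i j
  simp [add_comm]

theorem borderedHankelDet_self (h : ℕ → R) (n : ℕ) :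
    borderedHankelDet h n n n = hankelDet h (n + 1) := by
  rw [hankelDet, ← det_submatrix_equiv_self (finSumFinEquiv (m := n) (n := 1)), borderedHankelDet]
  congr 1
  ext i j
  rcases i with i | i <;> rcases j with j | j <;> simp

theorem hankelDet_add_two (h : ℕ → R) (n : ℕ) :
    hankelDet h (n + 2) = det (fromBlocks (of fun i j : Fin n => h (i + j))
      (of fun (i : Fin n) (j : Fin 2) => h (i + (n + j)))
      (of fun (i : Fin 2) (j : Fin n) => h (n + i + j))
      (of fun i j : Fin 2 => h (n + i + (n + j)))) := by
  rw [hankelDet, ← det_submatrix_equiv_self (finSumFinEquiv (m := n) (n := 2))]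
  congr 1
  ext i j
  rcases i with i | i <;> rcases j with j | j <;> simp

theorem borderedHankelDet_eq_fromBlocks (h : ℕ → R) (n a b : ℕ) :
    borderedHankelDet h n a b = det (fromBlocks (of fun i j : Fin n => h (i + j))
      (of fun (i : Fin n) (_ : Fin 1) => h (i + b))
      (of fun (_ : Fin 1) (j : Fin n) => h (a + j))
      (of fun _ _ : Fin 1 => h (a + b))) := by
  rw [borderedHankelDet]
  congr 1
  ext i j
  rcases i with i | i <;> rcases j with j | j <;> simp

theorem hankelDet_jacobi_field {K : Type*} [Field K] (h : ℕ → K) (n : ℕ)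
    (hn : hankelDet h n ≠ 0) :
    hankelDet h (n + 2) * hankelDet h n =
      borderedHankelDet h n n n * borderedHankelDet h n (n + 1) (n + 1) -
        borderedHankelDet h n n (n + 1) * borderedHankelDet h n (n + 1) n := by
  rw [hankelDet_add_two]
  simp only [borderedHankelDet_eq_fromBlocks]
  rw [hankelDet] at *
  set A : Matrix (Fin n) (Fin n) K := of fun i j : Fin n => h (i + j)
  let _ : Invertible A := invertibleOfIsUnitDet A (isUnit_iff_ne_zero.mpr hn)
  simp only [det_fromBlocks₁₁, det_fin_two, det_fin_one]
  simp only [Matrix.sub_apply, mul_apply, of_apply, Fin.val_zero, Fin.val_one, add_zero]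
  ring

/-- The Desnanot–Jacobi identity for Hankel determinants. -/
theorem hankelDet_jacobi [IsDomain R] (h : ℕ → R) (n : ℕ) (hn : hankelDet h n ≠ 0) :
    hankelDet h (n + 2) * hankelDet h n =
      borderedHankelDet h n n n * borderedHankelDet h n (n + 1) (n + 1) -
        borderedHankelDet h n n (n + 1) * borderedHankelDet h n (n + 1) n := by
  have hinj : Function.Injective (algebraMap R (FractionRing R)) :=
    IsFractionRing.injective R (FractionRing R)
  apply hinj
  simp only [map_sub, map_mul, map_hankelDet, map_borderedHankelDet]
  apply hankelDet_jacobi_field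
  rw [← map_hankelDet]
  exact fun h0 => hn (hinj (h0.trans (map_zero _).symm))

end Hankel

section Derivation

open Matrix

variable {R : Type*} [CommRing R]

theorem Derivation.map_prod_eq_sum {ι : Type*} [DecidableEq ι] (D : Derivation ℤ R R)
    (s : Finset ι) (f : ι → R) :
    D (∏ i ∈ s, f i) = ∑ j ∈ s, ∏ i ∈ s, if i = j then D (f i) else f i := by
  induction s using Finset.induction_on with
  | empty => simp
  | insert a s ha ih =>
    rw [Finset.prod_insert ha, D.leibniz, ih, Finset.sum_insert ha, Finset.prod_insert ha,
      if_pos rfl, smul_eq_mul, smul_eq_mul, Finset.mul_sum, add_comm]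
    congr 1
    · rw [mul_comm]
      congr 1
      refine Finset.prod_congr rfl fun i hi => ?_
      rw [if_neg (ne_of_mem_of_not_mem hi ha)]
    · refine Finset.sum_congr rfl fun j hj => ?_
      rw [Finset.prod_insert ha, if_neg (ne_of_mem_of_not_mem hj ha).symm]

theorem Derivation.map_det_eq_sum {ι : Type*} [DecidableEq ι] [Fintype ι] (D : Derivation ℤ R R)
    (M : Matrix ι ι R) :
    D M.det = ∑ j, (M.updateCol j fun i => D (M i j)).det := by
  simp only [det_apply', map_sum, updateCol_apply]
  rw [Finset.sum_comm]
  refine Finset.sum_congr rfl fun σ _ => ?_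
  rw [D.leibniz, D.map_intCast, smul_zero, add_zero, D.map_prod_eq_sum, smul_eq_mul,
    Finset.mul_sum]
  refine Finset.sum_congr rfl fun j _ => ?_
  congr 1
  refine Finset.prod_congr rfl fun i _ => ?_
  split_ifs with hij
  · rw [hij]
  · rfl

theorem derivation_borderedHankelDet_right (D : Derivation ℤ R R) {h : ℕ → R}
    (hD : ∀ k, D (h k) = h (k + 1)) (n a : ℕ) :
    D (borderedHankelDet h n a n) = borderedHankelDet h n a (n + 1) := by
  rw [borderedHankelDet, D.map_det_eq_sum, Fintype.sum_sum_type, Finset.sum_eq_zero, zero_add,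
    Fin.sum_univ_one, borderedHankelDet]
  · congr 1
    ext i j
    rcases j with j | j
    · simp
    · simp [hD, Subsingleton.elim j 0, add_assoc]
  · intro j _
    by_cases hj : (j : ℕ) + 1 < n
    · refine det_zero_of_column_eq (i := Sum.inl j) (j := Sum.inl ⟨j + 1, hj⟩) ?_ fun k => ?_
      · simp [Fin.ext_iff]
      · simp [hD, Fin.ext_iff, add_assoc]
    · refine det_zero_of_column_eq (i := Sum.inl j) (j := Sum.inr 0) (by simp) fun k => ?_
      have : (j : ℕ) + 1 = n := by omega
      simp [hD, add_assoc, this]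

theorem derivation_hankelDet_succ (D : Derivation ℤ R R) {h : ℕ → R}
    (hD : ∀ k, D (h k) = h (k + 1)) (n : ℕ) :
    D (hankelDet h (n + 1)) = borderedHankelDet h n n (n + 1) := by
  rw [← borderedHankelDet_self, derivation_borderedHankelDet_right D hD]

theorem derivation_derivation_hankelDet_succ (D : Derivation ℤ R R) {h : ℕ → R}
    (hD : ∀ k, D (h k) = h (k + 1)) (n : ℕ) :
    D (D (hankelDet h (n + 1))) = borderedHankelDet h n (n + 1) (n + 1) := by
  rw [derivation_hankelDet_succ D hD, borderedHankelDet_comm,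
    derivation_borderedHankelDet_right D hD]

/-- The Toda equation for Hankel determinants of iterated derivatives. -/
theorem hankelDet_toda [IsDomain R] (D : Derivation ℤ R R) {h : ℕ → R}
    (hD : ∀ k, D (h k) = h (k + 1)) (n : ℕ) (hn : hankelDet h n ≠ 0) :
    hankelDet h (n + 2) * hankelDet h n =
      hankelDet h (n + 1) * D (D (hankelDet h (n + 1))) - D (hankelDet h (n + 1)) ^ 2 := by
  rw [hankelDet_jacobi h n hn, derivation_derivation_hankelDet_succ D hD,
    derivation_hankelDet_succ D hD, borderedHankelDet_self,
    borderedHankelDet_comm h n (n + 1) n]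
  ring

end Derivation

section Airy

variable {R : Type*} [CommRing R]

/-- The Hankel determinant of size `n - 1`, with the convention that it vanishes for `n = 0`. -/
def hankelDetPred (h : ℕ → R) : ℕ → R
  | 0 => 0
  | n + 1 => hankelDet h n

theorem hankelDet_zero (h : ℕ → R) : hankelDet h 0 = 1 := by
  simp [hankelDet]

theorem hankelDet_one (h : ℕ → R) : hankelDet h 1 = h 0 := by
  simp [hankelDet]

/-- One step of the Bäcklund transformation, in bilinear form. -/
theorem bilinear_step [IsDomain R] (D : Derivation ℤ R R) {t a b c d : R} (n : ℕ)
    (ht : D t = 1) (hb : b ≠ 0) (hc : c ≠ 0)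
    (hToda : c * a = b * D (D b) - D b ^ 2) (hToda' : d * b = c * D (D c) - D c ^ 2)
    (hA : D c * a - c * D a = n * b ^ 2)
    (hB : D (D c) * b - 2 * D c * D b + c * D (D b) = t * b * c) :
    D d * b - d * D b = (n + 1) * c ^ 2 ∧
      D (D d) * c - 2 * D d * D c + d * D (D c) = t * c * d := by
  have dsq : ∀ u : R, D (u ^ 2) = 2 * u * D u := fun u => by
    rw [D.leibniz_pow]; simp; ring
  have dtwo : D (2 : R) = 0 := by exact_mod_cast D.map_natCast 2
  have dn : D ((n : R) + 1) = 0 := by simp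
  have hA' : D d * b - d * D b = (n + 1) * c ^ 2 := by
    have e₁ := congrArg D hB
    have e₂ := congrArg D hToda
    have e₃ := congrArg D hToda'
    simp only [map_add, map_sub, D.leibniz, smul_eq_mul, dsq, dtwo, ht] at e₁ e₂ e₃
    apply mul_left_cancel₀ (pow_ne_zero 2 hb)
    linear_combination b ^ 2 * e₃ - 2 * b * D b * hToda' + b * c * e₁ - (b * D c + c * D b) * hB
      + c ^ 2 * e₂ - 2 * c * D c * hToda + c ^ 2 * hA
  refine ⟨hA', ?_⟩
  have e := congrArg D hA'
  simp only [map_sub, D.leibniz, smul_eq_mul, dsq, dn] at e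
  apply mul_left_cancel₀ hb
  apply mul_left_cancel₀ hc
  linear_combination c * c * e - 2 * c * D c * hA' + c * d * hB

theorem hankelDet_airy [IsDomain R] [CharZero R] (D : Derivation ℤ R R) {h : ℕ → R} {t : R}
    (hD : ∀ k, D (h k) = h (k + 1)) (ht : D t = 1) (h₀ : h 0 ≠ 0) (h₂ : h 2 = t * h 0) (n : ℕ) :
    hankelDet h n ≠ 0 ∧ hankelDet h (n + 1) ≠ 0 ∧
    hankelDet h (n + 1) * hankelDetPred h n =
      hankelDet h n * D (D (hankelDet h n)) - D (hankelDet h n) ^ 2 ∧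
    D (hankelDet h (n + 1)) * hankelDetPred h n - hankelDet h (n + 1) * D (hankelDetPred h n) =
      n * hankelDet h n ^ 2 ∧
    D (D (hankelDet h (n + 1))) * hankelDet h n - 2 * D (hankelDet h (n + 1)) * D (hankelDet h n)
      + hankelDet h (n + 1) * D (D (hankelDet h n)) = t * hankelDet h n * hankelDet h (n + 1) := by
  induction n with
  | zero => simp [hankelDet_zero, hankelDet_one, hankelDetPred, h₀, h₂, hD]
  | succ n ih =>
    obtain ⟨hb, hc, hToda, hA, hB⟩ := ih
    have hToda' := hankelDet_toda D hD n hb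
    obtain ⟨hA', hB'⟩ := bilinear_step D n ht hb hc hToda hToda' hA hB
    refine ⟨hc, fun hd => ?_, hToda', ?_, hB'⟩
    · rw [hd, map_zero, zero_mul, zero_mul, sub_zero] at hA'
      exact mul_ne_zero (by exact_mod_cast n.succ_ne_zero) (pow_ne_zero 2 hc) hA'.symm
    · push_cast
      exact hA'

end Airy

section Evaluation

open MvPolynomial

/-- The derivation on `ℤ[t, x, y]` with `t' = 1`, `x' = y` and `y' = t x`. -/
noncomputable def airyDerivation :
    Derivation ℤ (MvPolynomial (Fin 3) ℤ) (MvPolynomial (Fin 3) ℤ) :=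
  mkDerivation ℤ ![1, X 2, X 0 * X 1]

/-- The formal iterated derivatives of the solution `x` of Airy's equation. -/
noncomputable def airySeq (k : ℕ) : MvPolynomial (Fin 3) ℤ :=
  airyDerivation^[k] (X 1)

theorem airyDerivation_airySeq (k : ℕ) : airyDerivation (airySeq k) = airySeq (k + 1) :=
  (Function.iterate_succ_apply' _ _ _).symm

theorem airyDerivation_X_zero : airyDerivation (X 0) = 1 := by
  simp [airyDerivation, mkDerivation_X]

theorem airySeq_two : airySeq 2 = X 0 * airySeq 0 := by
  simp [airySeq, airyDerivation, mkDerivation_X]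

/-- Evaluation of a polynomial in `t, x, y` at `(s, φ s, φ' s)`. -/
noncomputable def airyEval (φ : ℝ → ℂ) (s : ℝ) : MvPolynomial (Fin 3) ℤ →ₐ[ℤ] ℂ :=
  aeval ![(s : ℂ), φ s, deriv φ s]

theorem hasDerivAt_airyEval {φ : ℝ → ℂ} (hφ : ContDiff ℝ (⊤ : ℕ∞) φ)
    (hAiry : ∀ t : ℝ, deriv (deriv φ) t = (t : ℂ) * φ t) (P : MvPolynomial (Fin 3) ℤ) (s : ℝ) :
    HasDerivAt (fun s => airyEval φ s P) (airyEval φ s (airyDerivation P)) s := by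
  have hφ₀ : Differentiable ℝ φ := hφ.differentiable (by simp)
  have hφ₁ : Differentiable ℝ (deriv φ) :=
    ((contDiff_infty_iff_deriv.mp hφ).2).differentiable (by simp)
  induction P using MvPolynomial.induction_on with
  | C a => simpa [airyEval, airyDerivation] using hasDerivAt_const s (a : ℂ)
  | add P Q hP hQ => simpa using hP.fun_add hQ
  | mul_X P i hP =>
    have hX : HasDerivAt (fun s => airyEval φ s (X i)) (airyEval φ s (airyDerivation (X i))) s := by
      fin_cases i
      · simpa [airyEval, airyDerivation, mkDerivation_X] using
          HasDerivAt.ofReal_comp (hasDerivAt_id s)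
      · simpa [airyEval, airyDerivation, mkDerivation_X] using (hφ₀ s).hasDerivAt
      · simpa [airyEval, airyDerivation, mkDerivation_X, hAiry] using (hφ₁ s).hasDerivAt
    simpa [mul_comm, add_comm] using hP.fun_mul hX

theorem iterate_deriv_eq_airyEval {φ : ℝ → ℂ} (hφ : ContDiff ℝ (⊤ : ℕ∞) φ)
    (hAiry : ∀ t : ℝ, deriv (deriv φ) t = (t : ℂ) * φ t) (k : ℕ) :
    deriv^[k] φ = fun s => airyEval φ s (airySeq k) := by
  induction k with
  | zero => ext s; simp [airySeq, airyEval]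
  | succ k ih =>
    rw [Function.iterate_succ_apply', ih]
    ext s
    rw [(hasDerivAt_airyEval hφ hAiry _ s).deriv, airyDerivation_airySeq]

theorem det_iterate_deriv_eq_airyEval {φ : ℝ → ℂ} (hφ : ContDiff ℝ (⊤ : ℕ∞) φ)
    (hAiry : ∀ t : ℝ, deriv (deriv φ) t = (t : ℂ) * φ t) (n : ℕ) (s : ℝ) :
    Matrix.det (Matrix.of fun i j : Fin n => deriv^[(i : ℕ) + (j : ℕ)] φ s) =
      airyEval φ s (hankelDet airySeq n) := by
  simp only [iterate_deriv_eq_airyEval hφ hAiry]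
  exact (map_hankelDet (airyEval φ s).toRingHom airySeq n).symm

end Evaluation

/-- the Hankel determinants of derivatives of an Airy function
give classical transcendental solutions of the Hamiltonian system S_II with
parameter `α = n`. -/
theorem airy_hankel_solves_SII
    (φ : ℝ → ℂ) (hφ : ContDiff ℝ (⊤ : ℕ∞) φ)
    (hAiry : ∀ t : ℝ, deriv (deriv φ) t = (t : ℂ) * φ t)
    (τ : ℤ → ℝ → ℂ)
    (hτ : ∀ m : ℤ, ∀ t : ℝ, τ m t =
      if m < 0 then 0
      else Matrix.det (Matrix.of fun i j : Fin m.toNat =>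
        deriv^[(i : ℕ) + (j : ℕ)] φ t))
    (n : ℕ)
    (q p : ℝ → ℂ)
    (hq : ∀ t, q t = deriv (τ (n + 1)) t / τ (n + 1) t - deriv (τ n) t / τ n t)
    (hp : ∀ t, p t = τ (n + 1) t * τ (n - 1) t / (τ n t) ^ 2) :
    ∀ t : ℝ, τ n t ≠ 0 → τ (n + 1) t ≠ 0 →
      deriv q t = -2 * p t - (q t) ^ 2 + (t : ℂ) ∧
      deriv p t = 2 * q t * p t - (n : ℂ) := by
  have hsucc : τ (n + 1) = fun s => airyEval φ s (hankelDet airySeq (n + 1)) := by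
    ext s
    rw [hτ, if_neg (by omega), ← det_iterate_deriv_eq_airyEval hφ hAiry]
    rfl
  have hself : τ n = fun s => airyEval φ s (hankelDet airySeq n) := by
    ext s
    rw [hτ, if_neg (by omega), ← det_iterate_deriv_eq_airyEval hφ hAiry]
    rfl
  have hpred : τ (n - 1) = fun s => airyEval φ s (hankelDetPred airySeq n) := by
    ext s
    rw [hτ]
    cases n with
    | zero => simp [hankelDetPred]
    | succ n =>
      rw [if_neg (by omega), hankelDetPred, ← det_iterate_deriv_eq_airyEval hφ hAiry,
        show ((n + 1 : ℕ) - 1 : ℤ) = (n : ℤ) by omega]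
      rfl
  have hX : (airySeq 0 : MvPolynomial (Fin 3) ℤ) ≠ 0 := MvPolynomial.X_ne_zero 1
  obtain ⟨-, -, hToda, hA, hB⟩ := hankelDet_airy airyDerivation airyDerivation_airySeq
    airyDerivation_X_zero hX airySeq_two n
  have hd := hasDerivAt_airyEval hφ hAiry
  simp only [hsucc, hself, hpred, (hd _ _).deriv] at hq hp ⊢
  generalize hankelDet airySeq (n + 1) = c at *
  generalize hankelDet airySeq n = b at *
  generalize hankelDetPred airySeq n = a at *
  intro t hb hc
  replace hToda := congrArg (airyEval φ t) hToda
  replace hA := congrArg (airyEval φ t) hA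
  replace hB := congrArg (airyEval φ t) hB
  have ht : airyEval φ t (MvPolynomial.X 0) = (t : ℂ) := by simp [airyEval]
  simp only [map_mul, map_sub, map_add, map_pow, map_natCast, map_ofNat, ht] at hToda hA hB
  have hq' : HasDerivAt q _ t :=
    (((hd (airyDerivation c) t).div (hd c t) hc).sub
      ((hd (airyDerivation b) t).div (hd b t) hb)).congr_of_eventuallyEq
      (Filter.Eventually.of_forall hq)
  have hp' : HasDerivAt p _ t :=
    (((hd c t).fun_mul (hd a t)).div ((hd b t).fun_pow 2) (pow_ne_zero 2 hb)).congr_of_eventuallyEq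
      (Filter.Eventually.of_forall hp)
  rw [hq'.deriv, hp'.deriv, hq, hp]
  generalize airyEval φ t (airyDerivation (airyDerivation c)) = c₂ at *
  generalize airyEval φ t (airyDerivation (airyDerivation b)) = b₂ at *
  generalize airyEval φ t (airyDerivation c) = c₁ at *
  generalize airyEval φ t (airyDerivation b) = b₁ at *
  generalize airyEval φ t (airyDerivation a) = a₁ at *
  generalize airyEval φ t c = c₀ at *
  generalize airyEval φ t b = b₀ at *
  generalize airyEval φ t a = a₀ at *
  constructor
  · rw [hToda]
    field_simp
    linear_combination b₀ * c₀ * hB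
  · field_simp
    linear_combination -b₀ ^ 2 * hA
end

section
/- With φ_{i,j} as in the context, on every open subinterval of (0,∞) on which φ_{0,0} and φ_{1,1} do not vanish: (f_0,f_1,f_2,f_3) = (0, √t·φ_{1,1}/φ_{0,0}, √t, √t·φ_{0,1}/φ_{0,0}) is a solution of the symmetric form of the Painlevé V equation with parameters (α_0,α_1,α_2,α_3) = (0, a, 1−c, c−a) (in particular f_0+f_2 = f_1+f_3 = √t), and q = −φ_{0,1}/φ_{1,1}, p = 0 is a solution of the Hamiltonian system S_V with κ∞ = a, κ₀ = c−a, θ = −c. -/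
open scoped Real

/-- Kummer's confluent hypergeometric function `F(a,c;t)` as an everywhere
convergent power series. -/
noncomputable def kummerF (a c : ℂ) (t : ℝ) : ℂ :=
  ∑' n : ℕ, (Polynomial.eval a (ascPochhammer ℂ n) /
    (Polynomial.eval c (ascPochhammer ℂ n) * (n.factorial : ℂ))) * (t : ℂ) ^ n

/-- The seed functions `φ_{i,j}`. -/
noncomputable def phiV (a c c₁ c₂ : ℂ) (i j : ℤ) (t : ℝ) : ℂ :=
  c₁ * (Complex.Gamma (a + i) * Complex.Gamma (c - a - i + j) / Complex.Gamma (c + j)) *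
      kummerF (a + i) (c + j) t
  + c₂ * (1 / (Complex.sin ((π : ℂ) * (c - a - i + j)) * Complex.Gamma (2 - c - j))) *
      ((t : ℂ) ^ (1 - c - (j : ℂ)) * kummerF (a - c + 1 + i - j) (2 - c - j) t)

/-- The coefficients of Kummer's series `F(a,c;t)`. -/
noncomputable def kummerCoeff (a c : ℂ) (n : ℕ) : ℂ :=
  Polynomial.eval a (ascPochhammer ℂ n) /
    (Polynomial.eval c (ascPochhammer ℂ n) * (n.factorial : ℂ))

theorem kummerF_eq_tsum (a c : ℂ) (t : ℝ) :
    kummerF a c t = ∑' n : ℕ, kummerCoeff a c n * (t : ℂ) ^ n := rfl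

theorem mul_ascPochhammer_eval_add_one (a : ℂ) (n : ℕ) :
    a * Polynomial.eval (a + 1) (ascPochhammer ℂ n) =
      Polynomial.eval a (ascPochhammer ℂ n) * (a + n) := by
  rw [← ascPochhammer_succ_eval, ascPochhammer_succ_left]
  simp

theorem ascPochhammer_eval_ne_zero_of_add_ne_zero {c : ℂ} (hc : ∀ n : ℕ, c + n ≠ 0) (n : ℕ) :
    Polynomial.eval c (ascPochhammer ℂ n) ≠ 0 := by
  induction n with
  | zero => simp
  | succ n ih =>
    rw [ascPochhammer_succ_eval]
    exact mul_ne_zero ih (hc n)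

theorem add_one_add_natCast_ne_zero {c : ℂ} (hc : ∀ n : ℕ, c + n ≠ 0) (n : ℕ) :
    c + 1 + n ≠ 0 := by
  have := hc (n + 1)
  push_cast at this
  rwa [add_assoc, add_comm (1 : ℂ)]

theorem kummerCoeff_succ (a c : ℂ) (n : ℕ) :
    kummerCoeff a c (n + 1) = (a + n) / ((c + n) * (n + 1)) * kummerCoeff a c n := by
  simp only [kummerCoeff, ascPochhammer_succ_eval, Nat.factorial_succ, Nat.cast_mul,
    Nat.cast_add, Nat.cast_one]
  rw [div_mul_div_comm]
  congr 1 <;> ring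

theorem kummerCoeff_succ_mul {c : ℂ} (a : ℂ) (hc : ∀ n : ℕ, c + n ≠ 0) (n : ℕ) :
    ((n + 1 : ℕ) : ℂ) * kummerCoeff a c (n + 1) = a / c * kummerCoeff (a + 1) (c + 1) n := by
  have h0 : c ≠ 0 := by simpa using hc 0
  have hn : ((n : ℂ) + 1) ≠ 0 := by exact_mod_cast n.succ_ne_zero
  have hf : (n.factorial : ℂ) ≠ 0 := by exact_mod_cast n.factorial_ne_zero
  have h1 := ascPochhammer_eval_ne_zero_of_add_ne_zero hc n
  have h2 := ascPochhammer_eval_ne_zero_of_add_ne_zero (add_one_add_natCast_ne_zero hc) n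
  have h3 := hc n
  have ea := mul_ascPochhammer_eval_add_one a n
  have ec := mul_ascPochhammer_eval_add_one c n
  rw [kummerCoeff_succ]
  simp only [kummerCoeff]
  rw [div_mul_div_comm, div_mul_div_comm, ← mul_assoc c, ec, ea]
  push_cast
  field_simp

theorem natCast_mul_kummerCoeff (a c : ℂ) (n : ℕ) :
    n * kummerCoeff a c n = a * (kummerCoeff (a + 1) c n - kummerCoeff a c n) := by
  have ea := mul_ascPochhammer_eval_add_one a n
  simp only [kummerCoeff]
  rw [mul_sub, mul_div_assoc', mul_div_assoc', mul_div_assoc', ea]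
  ring

theorem add_natCast_mul_kummerCoeff {c : ℂ} (a : ℂ) (hc : ∀ n : ℕ, c + n ≠ 0) (n : ℕ) :
    (c + n) * kummerCoeff a (c + 1) n = c * kummerCoeff a c n := by
  have hf : (n.factorial : ℂ) ≠ 0 := by exact_mod_cast n.factorial_ne_zero
  have h1 := ascPochhammer_eval_ne_zero_of_add_ne_zero hc n
  have h2 := ascPochhammer_eval_ne_zero_of_add_ne_zero (add_one_add_natCast_ne_zero hc) n
  have ec := mul_ascPochhammer_eval_add_one c n
  simp only [kummerCoeff]
  field_simp
  linear_combination (-Polynomial.eval a (ascPochhammer ℂ n)) * ec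

theorem tendsto_kummerCoeff_ratio (a c z : ℂ) :
    Filter.Tendsto (fun n : ℕ => (a + n) / ((c + n) * (n + 1)) * z) Filter.atTop (nhds 0) := by
  have h1 : Filter.Tendsto (fun n : ℕ => (a + n) / (c + n)) Filter.atTop (nhds 1) := by
    simpa using tendsto_add_mul_div_add_mul_atTop_nhds a c (1 : ℂ) (d := 1) one_ne_zero
  have h2 : Filter.Tendsto (fun n : ℕ => (1 : ℂ) / (n + 1)) Filter.atTop (nhds 0) :=
    tendsto_one_div_add_atTop_nhds_zero_nat
  have := (h1.mul h2).mul_const z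
  simp only [mul_zero, zero_mul] at this
  refine this.congr fun n => ?_
  rw [div_mul_div_comm, mul_one]

theorem summable_kummerCoeff_mul_pow (a c z : ℂ) :
    Summable fun n : ℕ => kummerCoeff a c n * z ^ n := by
  have h := (tendsto_kummerCoeff_ratio a c z).norm
  rw [norm_zero] at h
  refine summable_of_ratio_norm_eventually_le (r := 1 / 2) (by norm_num) ?_
  filter_upwards [h.eventually_le_const (show (0 : ℝ) < 1 / 2 by norm_num)] with n hn
  rw [kummerCoeff_succ, pow_succ]
  calc _ = ‖(a + n) / ((c + n) * (n + 1)) * z‖ * ‖kummerCoeff a c n * z ^ n‖ := by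
        rw [← norm_mul]; congr 1; ring
    _ ≤ _ := by gcongr

/-- `F(a,c;t)` may be differentiated term by term. -/
theorem hasDerivAt_kummerF_tsum {c : ℂ} (a : ℂ) (hc : ∀ n : ℕ, c + n ≠ 0) (t : ℝ) :
    HasDerivAt (kummerF a c) (∑' n : ℕ, kummerCoeff a c n * (n * (t : ℂ) ^ (n - 1))) t := by
  set R : ℝ := |t| + 1
  have hR : 0 < R := by positivity
  have hsum : Summable fun n : ℕ => ‖kummerCoeff a c n * (n * (R : ℂ) ^ (n - 1))‖ := by
    rw [← summable_nat_add_iff 1]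
    have := ((summable_kummerCoeff_mul_pow (a + 1) (c + 1) R).mul_left (a / c)).norm
    refine this.congr fun n => ?_
    rw [← mul_assoc, ← kummerCoeff_succ_mul a hc, Nat.add_sub_cancel]
    congr 1; ring
  have hR' : ‖(R : ℂ)‖ = R := by simp [abs_of_pos hR]
  have ht : (t : ℂ) ∈ Metric.ball (0 : ℂ) R := by simp [R]
  refine (hasDerivAt_tsum_of_isPreconnected (g := fun n z => kummerCoeff a c n * z ^ n)
    (g' := fun n z => kummerCoeff a c n * (n * z ^ (n - 1))) hsum Metric.isOpen_ball (convex_ball (0 : ℂ) R).isPreconnected (fun n z _ => ?_)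
    (fun n z hz => ?_) ht (summable_kummerCoeff_mul_pow a c t) ht).comp_ofReal
  · exact (hasDerivAt_pow n z).const_mul (kummerCoeff a c n)
  · rw [mem_ball_zero_iff] at hz
    simp only [norm_mul, norm_pow, hR']
    gcongr

theorem hasDerivAt_kummerF {c : ℂ} (a : ℂ) (hc : ∀ n : ℕ, c + n ≠ 0) (t : ℝ) :
    HasDerivAt (kummerF a c) (a / c * kummerF (a + 1) (c + 1) t) t := by
  convert hasDerivAt_kummerF_tsum a hc t using 1
  have hterm (n : ℕ) : kummerCoeff a c (n + 1) * (((n + 1 : ℕ) : ℂ) * (t : ℂ) ^ (n + 1 - 1)) =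
      a / c * (kummerCoeff (a + 1) (c + 1) n * (t : ℂ) ^ n) := by
    rw [← mul_assoc (a / c), ← kummerCoeff_succ_mul a hc, Nat.add_sub_cancel]
    ring
  have hs : Summable fun n : ℕ => kummerCoeff a c n * (n * (t : ℂ) ^ (n - 1)) := by
    rw [← summable_nat_add_iff 1]
    simp only [hterm]
    exact (summable_kummerCoeff_mul_pow (a + 1) (c + 1) t).mul_left _
  rw [hs.tsum_eq_zero_add]
  simp only [hterm, tsum_mul_left, ← kummerF_eq_tsum]
  simp

theorem mul_tsum_kummerCoeff_deriv (a c : ℂ) (t : ℝ) :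
    t * ∑' n : ℕ, kummerCoeff a c n * (n * (t : ℂ) ^ (n - 1)) =
      ∑' n : ℕ, n * kummerCoeff a c n * (t : ℂ) ^ n := by
  rw [← tsum_mul_left]
  refine tsum_congr fun n => ?_
  cases n with
  | zero => simp
  | succ n => rw [Nat.add_sub_cancel, pow_succ]; ring

/-- The derivative of `F(a,c;t)` times `t` equals `a (F(a+1,c) - F(a,c))`. -/
theorem mul_kummerF_deriv_eq_sub {c : ℂ} (a : ℂ) (hc : ∀ n : ℕ, c + n ≠ 0) (t : ℝ) :
    t * (a / c * kummerF (a + 1) (c + 1) t) = a * (kummerF (a + 1) c t - kummerF a c t) := by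
  rw [(hasDerivAt_kummerF a hc t).unique (hasDerivAt_kummerF_tsum a hc t),
    mul_tsum_kummerCoeff_deriv, kummerF_eq_tsum, kummerF_eq_tsum,
    ← (summable_kummerCoeff_mul_pow _ _ _).tsum_sub (summable_kummerCoeff_mul_pow _ _ _),
    ← tsum_mul_left]
  refine tsum_congr fun n => ?_
  rw [natCast_mul_kummerCoeff]
  ring

/-- The contiguity relation `a F(a+1,c+1) + (c-a) F(a,c+1) = c F(a,c)`. -/
theorem kummerF_contiguous {c : ℂ} (a : ℂ) (hc : ∀ n : ℕ, c + n ≠ 0) (t : ℝ) :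
    a * kummerF (a + 1) (c + 1) t + (c - a) * kummerF a (c + 1) t = c * kummerF a c t := by
  have hterm (n : ℕ) : a * (kummerCoeff (a + 1) (c + 1) n * (t : ℂ) ^ n) +
      (c - a) * (kummerCoeff a (c + 1) n * (t : ℂ) ^ n) = c * (kummerCoeff a c n * (t : ℂ) ^ n) := by
    have h1 := natCast_mul_kummerCoeff a (c + 1) n
    have h2 := add_natCast_mul_kummerCoeff a hc n
    linear_combination (t : ℂ) ^ n * (h2 - h1)
  simp only [kummerF_eq_tsum, ← tsum_mul_left]
  rw [← ((summable_kummerCoeff_mul_pow _ _ _).mul_left _).tsum_add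
    ((summable_kummerCoeff_mul_pow _ _ _).mul_left _)]
  exact tsum_congr hterm

theorem hasDerivAt_ofReal_cpow_neg (c : ℂ) {t : ℝ} (ht : 0 < t) (hc : c ≠ 0) :
    HasDerivAt (fun x : ℝ => (x : ℂ) ^ (-c)) (-c * (t : ℂ) ^ (-c) / t) t := by
  have h := hasDerivAt_ofReal_cpow_const ht.ne' (neg_ne_zero.mpr hc)
  rwa [Complex.cpow_sub _ _ (by exact_mod_cast ht.ne'), Complex.cpow_one, ← mul_div_assoc] at h

/-- The seed functions `φ₀₀`, `φ₀₁`, `φ₁₁` written in terms of common constants. -/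
theorem exists_phiV_eq (a c c₁ c₂ : ℂ) (ha : a ≠ 0) (hc : c ≠ 0) (hc1 : 1 - c ≠ 0)
    (hca : c - a ≠ 0) : ∃ A B : ℂ, ∀ t : ℝ,
      phiV a c c₁ c₂ 0 0 t =
        A * c * kummerF a c t + B * ((t : ℂ) ^ (1 - c) * kummerF (a - c + 1) (2 - c) t) ∧
      phiV a c c₁ c₂ 0 1 t = A * (c - a) * kummerF a (c + 1) t -
        B * (1 - c) * ((t : ℂ) ^ (-c) * kummerF (a - c) (1 - c) t) ∧
      phiV a c c₁ c₂ 1 1 t = A * a * kummerF (a + 1) (c + 1) t +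
        B * (1 - c) * ((t : ℂ) ^ (-c) * kummerF (a - c + 1) (1 - c) t) := by
  have g1 := Complex.Gamma_add_one a ha
  have g2 := Complex.Gamma_add_one c hc
  have g3 := Complex.Gamma_add_one (c - a) hca
  have g4 := Complex.Gamma_add_one (1 - c) hc1
  have e4 : 1 - c + 1 = 2 - c := by ring
  rw [e4] at g4
  refine ⟨c₁ * (Complex.Gamma a * Complex.Gamma (c - a) / Complex.Gamma c) / c,
    c₂ * (1 / (Complex.sin (π * (c - a)) * Complex.Gamma (2 - c))), fun t => ⟨?_, ?_, ?_⟩⟩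
  · simp only [phiV, Int.cast_zero, add_zero, sub_zero]
    rw [div_mul_cancel₀ _ hc]
  · have es : Complex.sin (π * (c - a + 1)) = -Complex.sin (π * (c - a)) := by
      rw [mul_add, mul_one, Complex.sin_add_pi]
    simp only [phiV, Int.cast_zero, Int.cast_one, add_zero, sub_zero]
    rw [es, g2, g3, show 2 - c - 1 = 1 - c by ring, show 1 - c - 1 = -c by ring,
      show a - c + 1 - 1 = a - c by ring, g4]
    simp only [mul_inv, div_eq_mul_inv, inv_neg]
    field_simp
    ring
  · simp only [phiV, Int.cast_one]
    rw [show c - a - 1 + 1 = c - a by ring, g1, g2, show 2 - c - 1 = 1 - c by ring,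
      show 1 - c - 1 = -c by ring, show a - c + 1 + 1 - 1 = a - c + 1 by ring, g4]
    simp only [mul_inv, div_eq_mul_inv]
    field_simp

/-- The contiguity relation and the first-order linear system satisfied by the seed functions. -/
theorem phiV_linear_system (a c c₁ c₂ : ℂ)
    (ha : a ∉ Set.range ((↑·) : ℤ → ℂ)) (hc : c ∉ Set.range ((↑·) : ℤ → ℂ))
    (hca : c - a ∉ Set.range ((↑·) : ℤ → ℂ)) {t : ℝ} (ht : 0 < t) :
    phiV a c c₁ c₂ 0 0 t = phiV a c c₁ c₂ 0 1 t + phiV a c c₁ c₂ 1 1 t ∧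
    HasDerivAt (phiV a c c₁ c₂ 0 0) (phiV a c c₁ c₂ 1 1 t) t ∧
    HasDerivAt (phiV a c c₁ c₂ 0 1)
      ((-a * phiV a c c₁ c₂ 0 1 t + (c - a) * phiV a c c₁ c₂ 1 1 t) / t) t ∧
    HasDerivAt (phiV a c c₁ c₂ 1 1)
      (phiV a c c₁ c₂ 1 1 t -
        (-a * phiV a c c₁ c₂ 0 1 t + (c - a) * phiV a c c₁ c₂ 1 1 t) / t) t := by
  have hcn (n : ℕ) : c + n ≠ 0 := fun h => hc ⟨-n, by push_cast; linear_combination -h⟩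
  have hdn (n : ℕ) : 1 - c + n ≠ 0 := fun h => hc ⟨n + 1, by push_cast; linear_combination h⟩
  have ha0 : a ≠ 0 := fun h => ha ⟨0, by simp [h]⟩
  have hc0 : c ≠ 0 := by simpa using hcn 0
  have hd0 : 1 - c ≠ 0 := by simpa using hdn 0
  have hca0 : c - a ≠ 0 := fun h => hca ⟨0, by simp [h]⟩
  obtain ⟨A, B, hAB⟩ := exists_phiV_eq a c c₁ c₂ ha0 hc0 hd0 hca0
  have hd2 : 1 - c + 1 = 2 - c := by ring
  have hcn' := add_one_add_natCast_ne_zero hcn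
  have hdn' := add_one_add_natCast_ne_zero hdn
  have relation (x : ℝ) (hx : 0 < x) :
      phiV a c c₁ c₂ 0 0 x = phiV a c c₁ c₂ 0 1 x + phiV a c c₁ c₂ 1 1 x := by
    have hx0 : (x : ℂ) ≠ 0 := by exact_mod_cast hx.ne'
    obtain ⟨h1, h2, h3⟩ := hAB x
    have k1 := kummerF_contiguous a hcn x
    have k2 := mul_kummerF_deriv_eq_sub (a - c) hdn x
    rw [hd2] at k2
    have k3 : x * kummerF (a - c + 1) (2 - c) x =
        (1 - c) * (kummerF (a - c + 1) (1 - c) x - kummerF (a - c) (1 - c) x) := by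
      have hac : a - c ≠ 0 := fun h => hca0 (by linear_combination -h)
      apply mul_left_cancel₀ hac
      field_simp at k2
      linear_combination (a - c) * k2
    rw [h1, h2, h3, sub_eq_add_neg 1 c, Complex.cpow_add _ _ hx0, Complex.cpow_one]
    linear_combination -A * k1 + B * (x : ℂ) ^ (-c) * k3
  have ht0 : (t : ℂ) ≠ 0 := by exact_mod_cast ht.ne'
  have hpow : HasDerivAt (fun x : ℝ => (x : ℂ) ^ (1 - c)) ((1 - c) * (t : ℂ) ^ (-c)) t := by
    have h := hasDerivAt_ofReal_cpow_const ht.ne' hd0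
    rwa [show 1 - c - 1 = -c by ring] at h
  have hneg := hasDerivAt_ofReal_cpow_neg c ht hc0
  have hpow_eq : (t : ℂ) ^ (1 - c) = t * (t : ℂ) ^ (-c) := by
    rw [sub_eq_add_neg, Complex.cpow_add _ _ ht0, Complex.cpow_one]
  have h00 : HasDerivAt (phiV a c c₁ c₂ 0 0) (phiV a c c₁ c₂ 1 1 t) t := by
    rw [funext fun x => (hAB x).1]
    rw [← hd2]
    refine (((hasDerivAt_kummerF a hcn t).const_mul (A * c)).add
      ((hpow.mul (hasDerivAt_kummerF (a - c + 1) hdn' t)).const_mul B)).congr_deriv ?_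
    have k1 := mul_kummerF_deriv_eq_sub (a - c + 1) hdn' t
    have k2 := kummerF_contiguous (a - c + 1) hdn t
    rw [(hAB t).2.2, hpow_eq]
    have e : A * c * (a / c * kummerF (a + 1) (c + 1) t) = A * a * kummerF (a + 1) (c + 1) t := by
      field_simp
    rw [e]
    linear_combination B * (t : ℂ) ^ (-c) * (k1 + k2)
  have h01 : HasDerivAt (phiV a c c₁ c₂ 0 1)
      ((-a * phiV a c c₁ c₂ 0 1 t + (c - a) * phiV a c c₁ c₂ 1 1 t) / t) t := by
    rw [(hAB t).2.1, (hAB t).2.2, funext fun x => (hAB x).2.1]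
    refine (((hasDerivAt_kummerF a hcn' t).const_mul (A * (c - a))).sub
      ((hneg.mul (hasDerivAt_kummerF (a - c) hdn t)).const_mul (B * (1 - c)))).congr_deriv ?_
    have k1 := mul_kummerF_deriv_eq_sub a hcn' t
    have k2 := mul_kummerF_deriv_eq_sub (a - c) hdn t
    rw [eq_div_iff ht0]
    have e : -c * (t : ℂ) ^ (-c) / t * t = -c * (t : ℂ) ^ (-c) := div_mul_cancel₀ _ ht0
    linear_combination A * (c - a) * k1 - B * (1 - c) * (t : ℂ) ^ (-c) * k2
      - B * (1 - c) * kummerF (a - c) (1 - c) t * e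
  refine ⟨relation t ht, h00, h01, (h00.sub h01).congr_of_eventuallyEq ?_⟩
  filter_upwards [lt_mem_nhds ht] with x hx
  simp [relation x hx]

/-- the Riccati solution of the symmetric form of P_V and of the
Hamiltonian system S_V built from Kummer functions:
`(f₀,f₁,f₂,f₃) = (0, √t φ_{1,1}/φ_{0,0}, √t, √t φ_{0,1}/φ_{0,0})` with
`(α₀,α₁,α₂,α₃) = (0, a, 1-c, c-a)`, and `q = -φ_{0,1}/φ_{1,1}`, `p = 0` with
`κ∞ = a`, `κ₀ = c-a`, `θ = -c`. -/
theorem pV_riccati_solution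
    (a c c₁ c₂ : ℂ)
    (ha : a ∉ Set.range ((↑·) : ℤ → ℂ))
    (hc : c ∉ Set.range ((↑·) : ℤ → ℂ))
    (hca : c - a ∉ Set.range ((↑·) : ℤ → ℂ))
    (U : Set ℝ) (hU : IsOpen U) (hU0 : U ⊆ Set.Ioi 0)
    (h00 : ∀ t ∈ U, phiV a c c₁ c₂ 0 0 t ≠ 0)
    (h11 : ∀ t ∈ U, phiV a c c₁ c₂ 1 1 t ≠ 0)
    (f₀ f₁ f₂ f₃ q p : ℝ → ℂ)
    (hf₀ : ∀ t, f₀ t = 0)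
    (hf₁ : ∀ t, f₁ t = (Real.sqrt t : ℂ) * phiV a c c₁ c₂ 1 1 t / phiV a c c₁ c₂ 0 0 t)
    (hf₂ : ∀ t, f₂ t = (Real.sqrt t : ℂ))
    (hf₃ : ∀ t, f₃ t = (Real.sqrt t : ℂ) * phiV a c c₁ c₂ 0 1 t / phiV a c c₁ c₂ 0 0 t)
    (hq : ∀ t, q t = -(phiV a c c₁ c₂ 0 1 t / phiV a c c₁ c₂ 1 1 t))
    (hp : ∀ t, p t = 0) :
    ∀ t ∈ U,
      ((t : ℂ) * deriv f₀ t =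
          f₀ t * f₂ t * (f₁ t - f₃ t) + (1 / 2 - (1 - c)) * f₀ t + 0 * f₂ t ∧
       (t : ℂ) * deriv f₁ t =
          f₁ t * f₃ t * (f₂ t - f₀ t) + (1 / 2 - (c - a)) * f₁ t + a * f₃ t ∧
       (t : ℂ) * deriv f₂ t =
          f₂ t * f₀ t * (f₃ t - f₁ t) + (1 / 2 - 0) * f₂ t + (1 - c) * f₀ t ∧
       (t : ℂ) * deriv f₃ t =
          f₃ t * f₁ t * (f₀ t - f₂ t) + (1 / 2 - a) * f₃ t + (c - a) * f₁ t ∧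
       f₀ t + f₂ t = (Real.sqrt t : ℂ) ∧ f₁ t + f₃ t = (Real.sqrt t : ℂ)) ∧
      ((t : ℂ) * deriv q t =
          2 * q t * (q t - 1) ^ 2 * p t
            - ((c - a) * (q t - 1) ^ 2 + (-c) * q t * (q t - 1) + (t : ℂ) * q t) ∧
       (t : ℂ) * deriv p t =
          -(((q t - 1) ^ 2 + 2 * q t * (q t - 1)) * (p t) ^ 2
              - (2 * (c - a) * (q t - 1) + (-c) * (2 * q t - 1) + (t : ℂ)) * p t
              + ((1 / 4) * ((c - a) + (-c)) ^ 2 - (1 / 4) * a ^ 2))) := by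
  intro t htU
  have ht : 0 < t := hU0 htU
  have ht0 : (t : ℂ) ≠ 0 := by exact_mod_cast ht.ne'
  obtain ⟨hrel, d00, d01, d11⟩ := phiV_linear_system a c c₁ c₂ ha hc hca ht
  have n00 := h00 t htU
  have n11 := h11 t htU
  have hs2 : (Real.sqrt t : ℂ) ^ 2 = t := by exact_mod_cast Real.sq_sqrt ht.le
  have hs0 : (Real.sqrt t : ℂ) ≠ 0 := by exact_mod_cast (Real.sqrt_pos.mpr ht).ne'
  have ds : HasDerivAt (fun x : ℝ => (Real.sqrt x : ℂ)) (Real.sqrt t / (2 * t)) t := by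
    refine (Real.hasDerivAt_sqrt ht.ne').ofReal_comp.congr_deriv ?_
    push_cast
    rw [← hs2]
    field_simp
  obtain rfl : f₀ = fun _ => 0 := funext hf₀
  obtain rfl : p = fun _ => 0 := funext hp
  obtain rfl : f₂ = fun x => (Real.sqrt x : ℂ) := funext hf₂
  have df₁ := (ds.mul d11).div d00 n00
  have df₃ := (ds.mul d01).div d00 n00
  have dq := (d01.div d11 n11).neg
  have ef₁ : deriv f₁ t = _ := (df₁.congr_of_eventuallyEq (.of_forall hf₁)).deriv
  have ef₃ : deriv f₃ t = _ := (df₃.congr_of_eventuallyEq (.of_forall hf₃)).deriv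
  have eq : deriv q t = _ := (dq.congr_of_eventuallyEq (.of_forall hq)).deriv
  rw [ef₁, ef₃, eq, ds.deriv, hf₁, hf₃, hq]
  simp only [Pi.mul_apply, deriv_const]
  generalize phiV a c c₁ c₂ 0 0 t = x at *
  generalize phiV a c c₁ c₂ 0 1 t = y at *
  generalize phiV a c c₁ c₂ 1 1 t = z at *
  generalize (Real.sqrt t : ℂ) = s at *
  subst hrel
  rw [← hs2] at ht0 ⊢
  refine ⟨⟨by ring, ?_, ?_, ?_, by ring, ?_⟩, ?_, by ring⟩
  · field_simp
    ring
  · field_simp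
    ring
  · field_simp
    ring
  · field_simp
    ring
  · field_simp
    ring
end
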